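/- arXiv:1703.04942 — 2 statements merged into one kernel-verified Lean document; each statement's English description precedes it below -/
import Mathlib

section
/- Let λ > 0, μ > 0, ν ≥ 0, n ∈ ℕ and x > 0. Then the left tempered fractional integral of the generalized Laguerre function 𝓛_n^{(−ν,λ)} satisfies (1/Γ(μ)) ∫₀^x e^{−λ(x−t)} (x−t)^{μ−1} t^ν e^{−λt} L_n^{(ν)}(2λt) dt = (Γ(n+1+ν)/Γ(n+1+ν+μ)) · x^{ν+μ} e^{−λx} L_n^{(ν+μ)}(2λx). -/
/-- The generalized Laguerre polynomial
L_n^{(α)}(x) = ∑_{j=0}^n (−1)^j (Γ(n+α+1)/(Γ(j+α+1)Γ(n−j+1))) x^j / j!. -/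
noncomputable def lagL (α : ℝ) (n : ℕ) (x : ℝ) : ℝ :=
  ∑ j ∈ Finset.range (n + 1),
    (-1 : ℝ) ^ j *
      (Real.Gamma ((n : ℝ) + α + 1) /
        (Real.Gamma ((j : ℝ) + α + 1) * Real.Gamma (((n - j : ℕ) : ℝ) + 1))) *
      x ^ j / (Nat.factorial j : ℝ)

/-- The Euler beta integral on `[0, x]`, in terms of the real Gamma function. -/
theorem integral_rpow_mul_sub_rpow {a b x : ℝ} (ha : 0 < a) (hb : 0 < b) (hx : 0 < x) :
    ∫ t in (0 : ℝ)..x, t ^ (a - 1) * (x - t) ^ (b - 1) =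
      x ^ (a + b - 1) * (Real.Gamma a * Real.Gamma b / Real.Gamma (a + b)) := by
  apply Complex.ofReal_injective
  have h := Complex.betaIntegral_scaled (a : ℂ) b hx
  rw [Complex.betaIntegral_eq_Gamma_mul_div _ _ (by simpa using ha) (by simpa using hb)] at h
  rw [← intervalIntegral.integral_ofReal]
  push_cast [Complex.ofReal_cpow hx.le, ← Complex.Gamma_ofReal]
  rw [← h]
  refine intervalIntegral.integral_congr fun t ht => ?_
  rw [Set.uIcc_of_le hx.le] at ht
  push_cast [Complex.ofReal_cpow ht.1, Complex.ofReal_cpow (sub_nonneg.2 ht.2)]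
  rfl

theorem intervalIntegrable_rpow_mul_sub_rpow {a b x : ℝ} (ha : 0 < a) (hb : 0 < b) (hx : 0 < x) :
    IntervalIntegrable (fun t : ℝ => t ^ (a - 1) * (x - t) ^ (b - 1)) MeasureTheory.volume 0 x := by
  apply intervalIntegral.intervalIntegrable_of_integral_ne_zero
  rw [integral_rpow_mul_sub_rpow ha hb hx]
  have := Real.Gamma_pos_of_pos ha
  have := Real.Gamma_pos_of_pos hb
  have := Real.Gamma_pos_of_pos (add_pos ha hb)
  positivity

/-- for λ > 0, μ > 0, ν ≥ 0, n ∈ ℕ, x > 0, the left tempered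
fractional integral of the generalized Laguerre function
𝓛_n^{(−ν,λ)}(t) = t^ν e^{−λt} L_n^{(ν)}(2λt) satisfies
(1/Γ(μ)) ∫₀^x e^{−λ(x−t)} (x−t)^{μ−1} t^ν e^{−λt} L_n^{(ν)}(2λt) dt
  = (Γ(n+1+ν)/Γ(n+1+ν+μ)) x^{ν+μ} e^{−λx} L_n^{(ν+μ)}(2λx). -/
theorem temperedIntL_GLF (lam mu ν : ℝ) (hlam : 0 < lam) (hmu : 0 < mu) (hν : 0 ≤ ν)
    (n : ℕ) (x : ℝ) (hx : 0 < x) :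
    (1 / Real.Gamma mu) *
        ∫ t in (0 : ℝ)..x,
          Real.exp (-(lam * (x - t))) * (x - t) ^ (mu - 1) *
            (t ^ ν * Real.exp (-(lam * t)) * lagL ν n (2 * lam * t))
      = (Real.Gamma ((n : ℝ) + 1 + ν) / Real.Gamma ((n : ℝ) + 1 + ν + mu)) *
          (x ^ (ν + mu) * Real.exp (-(lam * x)) * lagL (ν + mu) n (2 * lam * x)) := by
  have hj : ∀ j : ℕ, 0 < (j : ℝ) + ν + 1 := fun j => by positivity
  have hexpand : ∫ t in (0 : ℝ)..x,
      Real.exp (-(lam * (x - t))) * (x - t) ^ (mu - 1) *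
        (t ^ ν * Real.exp (-(lam * t)) * lagL ν n (2 * lam * t)) =
      ∫ t in (0 : ℝ)..x, ∑ j ∈ Finset.range (n + 1),
        (Real.exp (-(lam * x)) * ((-1 : ℝ) ^ j *
          (Real.Gamma ((n : ℝ) + ν + 1) /
            (Real.Gamma ((j : ℝ) + ν + 1) * Real.Gamma (((n - j : ℕ) : ℝ) + 1))) *
          (2 * lam) ^ j / (Nat.factorial j : ℝ))) *
        (t ^ ((j : ℝ) + ν + 1 - 1) * (x - t) ^ (mu - 1)) := by
    refine intervalIntegral.integral_congr_ae (Filter.Eventually.of_forall fun t ht => ?_)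
    rw [Set.uIoc_of_le hx.le] at ht
    have hexp : Real.exp (-(lam * x)) =
        Real.exp (-(lam * (x - t))) * Real.exp (-(lam * t)) := by
      rw [← Real.exp_add]
      ring_nf
    simp only [lagL, Finset.mul_sum]
    refine Finset.sum_congr rfl fun j _ => ?_
    rw [hexp, add_sub_cancel_right, Real.rpow_add ht.1, Real.rpow_natCast, mul_pow (2 * lam)]
    ring
  rw [hexpand, intervalIntegral.integral_finsetSum fun j _ =>
    (intervalIntegrable_rpow_mul_sub_rpow (hj j) hmu hx).const_mul _]
  simp only [intervalIntegral.integral_const_mul, lagL, Finset.mul_sum]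
  refine Finset.sum_congr rfl fun j _ => ?_
  rw [integral_rpow_mul_sub_rpow (hj j) hmu hx,
    show (j : ℝ) + ν + 1 + mu - 1 = (ν + mu) + j by ring, Real.rpow_add hx, Real.rpow_natCast,
    show (n : ℝ) + 1 + ν + mu = n + (ν + mu) + 1 by ring,
    show (n : ℝ) + 1 + ν = n + ν + 1 by ring,
    show (j : ℝ) + ν + 1 + mu = j + (ν + mu) + 1 by ring, mul_pow (2 * lam)]
  have h1 := (Real.Gamma_pos_of_pos hmu).ne'
  have h2 := (Real.Gamma_pos_of_pos (hj j)).ne'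
  have h3 : Real.Gamma ((n : ℝ) + (ν + mu) + 1) ≠ 0 :=
    (Real.Gamma_pos_of_pos (by positivity)).ne'
  have h4 : Real.Gamma ((j : ℝ) + (ν + mu) + 1) ≠ 0 :=
    (Real.Gamma_pos_of_pos (by positivity)).ne'
  have h5 : Real.Gamma (((n - j : ℕ) : ℝ) + 1) ≠ 0 :=
    (Real.Gamma_pos_of_pos (by positivity)).ne'
  field_simp
end

section
/- Let λ > 0, k ∈ ℕ with k ≥ 1, μ ∈ [k−1, k), ν ≥ μ, n ∈ ℕ and x > 0. Then the left tempered fractional derivative of order μ of the generalized Laguerre function 𝓛_n^{(−ν,λ)} satisfies e^{−λx} · (the k-th iterated derivative at x of y ↦ (1/Γ(k−μ)) ∫₀^y (y−t)^{k−μ−1} t^ν L_n^{(ν)}(2λt) dt) = (Γ(n+1+ν)/Γ(n+1+ν−μ)) · x^{ν−μ} e^{−λx} L_n^{(ν−μ)}(2λx). -/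
/-- The Euler beta integral on `(0, y)`: the unnormalised Riemann–Liouville integral of a power. -/
theorem integral_sub_rpow_mul_rpow {s b y : ℝ} (hs : 0 < s) (hb : 0 < b) (hy : 0 < y) :
    ∫ t in (0 : ℝ)..y, (y - t) ^ (s - 1) * t ^ (b - 1) =
      Real.Gamma s * Real.Gamma b / Real.Gamma (s + b) * y ^ (s + b - 1) := by
  have hscaled := Complex.betaIntegral_scaled (b : ℂ) (s : ℂ) hy
  rw [Complex.betaIntegral_eq_Gamma_mul_div _ _ (by simpa) (by simpa)] at hscaled
  apply Complex.ofReal_injective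
  rw [← intervalIntegral.integral_ofReal]
  calc ∫ t in (0 : ℝ)..y, (((y - t) ^ (s - 1) * t ^ (b - 1) : ℝ) : ℂ)
      = ∫ t in (0 : ℝ)..y, (t : ℂ) ^ ((b : ℂ) - 1) * ((y : ℂ) - t) ^ ((s : ℂ) - 1) := by
        refine intervalIntegral.integral_congr fun t ht => ?_
        rw [Set.uIcc_of_le hy.le] at ht
        push_cast [Complex.ofReal_cpow ht.1, Complex.ofReal_cpow (sub_nonneg.2 ht.2)]
        ring
    _ = _ := by
        rw [hscaled, ← Complex.ofReal_add, Complex.Gamma_ofReal, Complex.Gamma_ofReal,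
          Complex.Gamma_ofReal]
        push_cast [Complex.ofReal_cpow hy.le]
        rw [add_comm (b : ℂ), add_comm b]
        ring

theorem intervalIntegrable_sub_rpow_mul_rpow {s b y : ℝ} (hs : 0 < s) (hb : 0 < b) (hy : 0 < y) :
    IntervalIntegrable (fun t => (y - t) ^ (s - 1) * t ^ (b - 1)) MeasureTheory.volume 0 y := by
  by_contra h
  have h0 := integral_sub_rpow_mul_rpow hs hb hy
  rw [intervalIntegral.integral_undef h] at h0
  have := Real.Gamma_pos_of_pos hs
  have := Real.Gamma_pos_of_pos hb
  have := Real.Gamma_pos_of_pos (add_pos hs hb)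
  exact absurd h0 (by positivity)

theorem descPochhammer_eval_mul_Gamma {r : ℝ} {k : ℕ} (h : 0 < r - k + 1) :
    (descPochhammer ℝ k).eval r * Real.Gamma (r - k + 1) = Real.Gamma (r + 1) := by
  induction k with
  | zero => simp
  | succ k ih =>
    push_cast at h ⊢
    have hrk : 0 < r - k := by linarith
    rw [descPochhammer_succ_eval, mul_assoc, show r - (k + 1) + 1 = r - k by ring,
      ← Real.Gamma_add_one hrk.ne', ih (by linarith)]

theorem iteratedDeriv_rpow_const_eq_Gamma {r : ℝ} {k : ℕ} (h : 0 < r - k + 1) (x : ℝ) :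
    iteratedDeriv k (fun y : ℝ => y ^ r) x =
      Real.Gamma (r + 1) / Real.Gamma (r - k + 1) * x ^ (r - k) := by
  rw [iteratedDeriv_eq_iterate, Real.iter_deriv_rpow_const, ← descPochhammer_eval_mul_Gamma h,
    mul_div_cancel_right₀ _ (Real.Gamma_pos_of_pos h).ne']

/-- The coefficient of `x ^ j` in `lagL α n x`. -/
noncomputable def lagLCoeff (α : ℝ) (n j : ℕ) : ℝ :=
  (-1 : ℝ) ^ j *
    (Real.Gamma ((n : ℝ) + α + 1) /
      (Real.Gamma ((j : ℝ) + α + 1) * Real.Gamma (((n - j : ℕ) : ℝ) + 1))) / (Nat.factorial j : ℝ)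

theorem rpow_mul_lagL (ν α c : ℝ) (n : ℕ) {t : ℝ} (ht : 0 < t) :
    t ^ ν * lagL α n (c * t) =
      ∑ j ∈ Finset.range (n + 1), lagLCoeff α n j * c ^ j * t ^ (ν + j) := by
  rw [lagL, Finset.mul_sum]
  refine Finset.sum_congr rfl fun j _ => ?_
  rw [lagLCoeff, Real.rpow_add_natCast ht.ne', mul_pow]
  ring

theorem integral_sub_rpow_mul_lagL {s ν y : ℝ} (c : ℝ) (n : ℕ) (hs : 0 < s) (hν : -1 < ν)
    (hy : 0 < y) :
    1 / Real.Gamma s * ∫ t in (0 : ℝ)..y, (y - t) ^ (s - 1) * (t ^ ν * lagL ν n (c * t)) =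
      ∑ j ∈ Finset.range (n + 1), lagLCoeff ν n j * c ^ j *
        (Real.Gamma (j + ν + 1) / Real.Gamma (j + ν + s + 1)) * y ^ (j + ν + s) := by
  have hpos (j : ℕ) : 0 < (j : ℝ) + ν + 1 := by
    have : (0 : ℝ) ≤ j := j.cast_nonneg
    linarith
  have hcongr : ∫ t in (0 : ℝ)..y, (y - t) ^ (s - 1) * (t ^ ν * lagL ν n (c * t)) =
      ∫ t in (0 : ℝ)..y, ∑ j ∈ Finset.range (n + 1), lagLCoeff ν n j * c ^ j *
        ((y - t) ^ (s - 1) * t ^ ((j : ℝ) + ν + 1 - 1)) := by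
    refine intervalIntegral.integral_congr_ae (Filter.Eventually.of_forall fun t ht => ?_)
    rw [Set.uIoc_of_le hy.le] at ht
    rw [rpow_mul_lagL ν ν c n ht.1, Finset.mul_sum]
    refine Finset.sum_congr rfl fun j _ => ?_
    rw [add_sub_cancel_right, add_comm (j : ℝ)]
    ring
  rw [hcongr, intervalIntegral.integral_finsetSum fun j _ =>
    (intervalIntegrable_sub_rpow_mul_rpow hs (hpos j) hy).const_mul _, Finset.mul_sum]
  refine Finset.sum_congr rfl fun j _ => ?_
  rw [intervalIntegral.integral_const_mul, integral_sub_rpow_mul_rpow hs (hpos j) hy,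
    show s + (j + ν + 1) = j + ν + s + 1 by ring, add_sub_cancel_right]
  have := (Real.Gamma_pos_of_pos hs).ne'
  field_simp

/-- for λ > 0, k ≥ 1, μ ∈ [k−1,k), ν ≥ μ, n ∈ ℕ, x > 0, the left
tempered fractional derivative of order μ of 𝓛_n^{(−ν,λ)}(t) = t^ν e^{−λt} L_n^{(ν)}(2λt):
e^{−λx} (d/dx)^k [(1/Γ(k−μ)) ∫₀^y (y−t)^{k−μ−1} t^ν L_n^{(ν)}(2λt) dt]|_{y=x}
  = (Γ(n+1+ν)/Γ(n+1+ν−μ)) x^{ν−μ} e^{−λx} L_n^{(ν−μ)}(2λx). -/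
theorem temperedDerivL_GLF (lam : ℝ) (hlam : 0 < lam) (k : ℕ) (hk : 1 ≤ k) (mu : ℝ)
    (hmu1 : (k : ℝ) - 1 ≤ mu) (hmu2 : mu < k) (ν : ℝ) (hν : mu ≤ ν)
    (n : ℕ) (x : ℝ) (hx : 0 < x) :
    Real.exp (-(lam * x)) *
        iteratedDeriv k
          (fun y => (1 / Real.Gamma ((k : ℝ) - mu)) *
            ∫ t in (0 : ℝ)..y, (y - t) ^ ((k : ℝ) - mu - 1) * (t ^ ν * lagL ν n (2 * lam * t))) x
      = (Real.Gamma ((n : ℝ) + 1 + ν) / Real.Gamma ((n : ℝ) + 1 + ν - mu)) *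
          (x ^ (ν - mu) * Real.exp (-(lam * x)) * lagL (ν - mu) n (2 * lam * x)) := by
  have hmu0 : 0 ≤ mu := by
    have : (1 : ℝ) ≤ k := by exact_mod_cast hk
    linarith
  have hs : 0 < (k : ℝ) - mu := by linarith
  have hsum : iteratedDeriv k
      (fun y => (1 / Real.Gamma ((k : ℝ) - mu)) *
        ∫ t in (0 : ℝ)..y, (y - t) ^ ((k : ℝ) - mu - 1) * (t ^ ν * lagL ν n (2 * lam * t))) x =
      iteratedDeriv k (fun y => ∑ j ∈ Finset.range (n + 1), lagLCoeff ν n j * (2 * lam) ^ j *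
        (Real.Gamma (j + ν + 1) / Real.Gamma (j + ν + (k - mu) + 1)) *
          y ^ (j + ν + (k - mu))) x := by
    refine Filter.EventuallyEq.iteratedDeriv_eq k ?_
    filter_upwards [lt_mem_nhds hx] with y hy
    exact integral_sub_rpow_mul_lagL (2 * lam) n hs (by linarith) hy
  rw [hsum, iteratedDeriv_fun_sum fun j _ =>
    contDiffAt_const.mul (Real.contDiffAt_rpow_const (Or.inl hx.ne')),
    mul_right_comm (x ^ (ν - mu)), rpow_mul_lagL _ _ _ _ hx, mul_comm, ← mul_assoc]
  congr 1
  rw [Finset.mul_sum]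
  refine Finset.sum_congr rfl fun j _ => ?_
  have hj : (0 : ℝ) ≤ j := j.cast_nonneg
  have hn : (0 : ℝ) ≤ n := n.cast_nonneg
  have hexp : (j : ℝ) + ν + (k - mu) - k = ν - mu + j := by ring
  rw [iteratedDeriv_const_mul_field, iteratedDeriv_rpow_const_eq_Gamma (by linarith), hexp,
    lagLCoeff, lagLCoeff, show (n : ℝ) + 1 + ν = n + ν + 1 by ring,
    show (n : ℝ) + ν + 1 - mu = n + (ν - mu) + 1 by ring,
    show ν - mu + j + 1 = j + (ν - mu) + 1 by ring]
  have h1 := (Real.Gamma_pos_of_pos (show 0 < (j : ℝ) + ν + 1 by linarith)).ne'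
  have h2 := (Real.Gamma_pos_of_pos (show 0 < (j : ℝ) + ν + (k - mu) + 1 by linarith)).ne'
  have h3 := (Real.Gamma_pos_of_pos (show 0 < (n : ℝ) + (ν - mu) + 1 by linarith)).ne'
  field_simp
end
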